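/- arXiv:2210.01907 — 7 statements merged into one kernel-verified Lean document; each statement's English description precedes it below -/
import Mathlib

section
/- For every natural number n ≥ 1 and every sequence of positive real numbers x_1, …, x_n, one has (∑_{i=1}^n x_i) / √(∑_{i=1}^n i · x_i²) ≤ √(1 + log n); equivalently, (∑_{i=1}^n x_i)² ≤ (1 + log n) · ∑_{i=1}^n i · x_i². -/
/-- Cauchy–Schwarz with the weights `i` and `1 / i`, and the logarithmic bound on the harmonic
numbers. -/
theorem sq_sum_Icc_le_one_add_log_mul_sum (n : ℕ) (x : ℕ → ℝ) :
    (∑ i ∈ Finset.Icc 1 n, x i) ^ 2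
      ≤ (1 + Real.log n) * ∑ i ∈ Finset.Icc 1 n, (i : ℝ) * x i ^ 2 := by
  have hharm : ∑ i ∈ Finset.Icc 1 n, (i : ℝ)⁻¹ ≤ 1 + Real.log n := by
    have h := harmonic_le_one_add_log n
    rw [harmonic_eq_sum_Icc] at h
    push_cast at h
    exact h
  refine (Finset.sum_sq_le_sum_mul_sum_of_sq_le_mul (f := fun i : ℕ => (i : ℝ)⁻¹)
    (g := fun i : ℕ => (i : ℝ) * x i ^ 2) _ (fun i _ => by positivity)
    (fun i _ => by positivity) fun i hi => ?_).trans
    (mul_le_mul_of_nonneg_right hharm (Finset.sum_nonneg fun i _ => by positivity))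
  have hi0 : (i : ℝ) ≠ 0 := Nat.cast_ne_zero.mpr (by have := (Finset.mem_Icc.mp hi).1; omega)
  exact le_of_eq (by field_simp)

/-- **Lemma F.1.** For every `n ≥ 1` and positive reals `x 1, …, x n`,
`(∑ xᵢ) / √(∑ i xᵢ²) ≤ √(1 + log n)`; equivalently
`(∑ xᵢ)² ≤ (1 + log n) ∑ i xᵢ²`. -/
theorem stmt_0 (n : ℕ) (hn : 1 ≤ n) (x : ℕ → ℝ)
    (hx : ∀ i ∈ Finset.Icc 1 n, 0 < x i) :
    (∑ i ∈ Finset.Icc 1 n, x i) / Real.sqrt (∑ i ∈ Finset.Icc 1 n, (i : ℝ) * x i ^ 2)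
      ≤ Real.sqrt (1 + Real.log n) ∧
    (∑ i ∈ Finset.Icc 1 n, x i) ^ 2
      ≤ (1 + Real.log n) * ∑ i ∈ Finset.Icc 1 n, (i : ℝ) * x i ^ 2 := by
  have key := sq_sum_Icc_le_one_add_log_mul_sum n x
  refine ⟨?_, key⟩
  have hlog : 0 ≤ 1 + Real.log n := by positivity
  refine div_le_of_le_mul₀ (Real.sqrt_nonneg _) (Real.sqrt_nonneg _) ?_
  rw [← Real.sqrt_mul hlog]
  exact Real.le_sqrt_of_sq_le key
end

section
/- Let {φ_t}_{t≥1} be a sequence of vectors in ℝ^d with ‖φ_t‖ ≤ 1 for all t, let Λ_0 ∈ ℝ^{d×d} be a symmetric positive definite matrix whose smallest eigenvalue is at least 1, and set Λ_t = Λ_0 + ∑_{i=1}^t φ_i φ_iᵀ. Then for every t ≥ 1, log(det Λ_t / det Λ_0) ≤ ∑_{i=1}^t φ_iᵀ Λ_{i−1}^{−1} φ_i ≤ 2 log(det Λ_t / det Λ_0). -/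
open Matrix

namespace Matrix

variable {n : Type*} [Fintype n] [DecidableEq n]

/-- The **matrix determinant lemma** for the rank-one update `vecMulVec u v`. -/
theorem det_add_vecMulVec {R : Type*} [CommRing R] {A : Matrix n n R} (hA : IsUnit A.det)
    (u v : n → R) : (A + vecMulVec u v).det = A.det * (1 + v ⬝ᵥ (A⁻¹ *ᵥ u)) := by
  rw [vecMulVec_eq Unit, det_add_replicateCol_mul_replicateRow hA, Matrix.mul_assoc,
    ← replicateCol_mulVec, det_unique (1 + _), add_apply, one_apply_eq,
    replicateRow_mul_replicateCol_apply]

/-- If the least eigenvalue of `A` is at least `1`, then the quadratic form of `A⁻¹` is bounded by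
the squared Euclidean norm. -/
theorem PosDef.dotProduct_inv_mulVec_le {A : Matrix n n ℝ} (hA : A.PosDef)
    (h : (A - 1).PosSemidef) (v : n → ℝ) : v ⬝ᵥ (A⁻¹ *ᵥ v) ≤ v ⬝ᵥ v := by
  set y := A⁻¹ *ᵥ v with hy
  have hAy : A *ᵥ y = v := by
    rw [hy, mulVec_mulVec, mul_nonsing_inv _ hA.det_pos.ne'.isUnit, one_mulVec]
  have h₁ := h.dotProduct_mulVec_nonneg y
  have h₂ : 0 ≤ (v - y) ⬝ᵥ (v - y) := dotProduct_self_star_nonneg (v - y)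
  simp only [star_trivial, sub_mulVec, one_mulVec, hAy, dotProduct_sub, sub_dotProduct] at h₁ h₂
  linarith [dotProduct_comm v y]

end Matrix

theorem Real.le_two_mul_log_one_add {x : ℝ} (h₀ : 0 ≤ x) (h₂ : x ≤ 2) :
    x ≤ 2 * Real.log (1 + x) := by
  have h := Real.le_log_one_add_of_nonneg h₀
  have : x / 2 ≤ 2 * x / (x + 2) := by
    rw [div_le_div_iff₀ (by norm_num) (by linarith)]
    nlinarith
  linarith

/-- **Elliptical Potential Lemma.** If `‖φ_t‖ ≤ 1` (Euclidean norm), `Λ₀` is symmetric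
positive definite with smallest eigenvalue at least `1` (i.e. `Λ₀ - 1` is positive
semidefinite), and `Λ_t = Λ₀ + ∑_{i=1}^t φ_i φ_iᵀ`, then for every `t ≥ 1`,
`log (det Λ_t / det Λ₀) ≤ ∑_{i=1}^t φ_iᵀ Λ_{i-1}⁻¹ φ_i ≤ 2 log (det Λ_t / det Λ₀)`. -/
theorem stmt_1 (d : ℕ) (φ : ℕ → EuclideanSpace ℝ (Fin d))
    (hφ : ∀ t, 1 ≤ t → ‖φ t‖ ≤ 1)
    (Λ₀ : Matrix (Fin d) (Fin d) ℝ) (hΛ₀sym : Λ₀.IsSymm) (hΛ₀pd : Λ₀.PosDef)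
    (hmin : (Λ₀ - 1).PosSemidef)
    (Λ : ℕ → Matrix (Fin d) (Fin d) ℝ)
    (hΛ : ∀ t, Λ t = Λ₀ + ∑ i ∈ Finset.Icc 1 t, Matrix.vecMulVec (φ i) (φ i))
    (t : ℕ) (ht : 1 ≤ t) :
    Real.log ((Λ t).det / Λ₀.det)
        ≤ ∑ i ∈ Finset.Icc 1 t, (φ i) ⬝ᵥ ((Λ (i - 1))⁻¹ *ᵥ (φ i)) ∧
    ∑ i ∈ Finset.Icc 1 t, (φ i) ⬝ᵥ ((Λ (i - 1))⁻¹ *ᵥ (φ i))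
        ≤ 2 * Real.log ((Λ t).det / Λ₀.det) := by
  have hsucc (k : ℕ) : Λ (k + 1) = Λ k + vecMulVec (φ (k + 1)) (φ (k + 1)) := by
    rw [hΛ, hΛ, Finset.sum_Icc_succ_top (Nat.le_add_left 1 k), add_assoc]
  have hV (v : Fin d → ℝ) : (vecMulVec v v).PosSemidef := by
    simpa using posSemidef_vecMulVec_self_star v
  have hS (k : ℕ) : (∑ i ∈ Finset.Icc 1 k, vecMulVec (φ i) (φ i)).PosSemidef :=
    posSemidef_sum _ fun i _ => hV (φ i)
  have hpd (k : ℕ) : (Λ k).PosDef := by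
    rw [hΛ]
    exact hΛ₀pd.add_posSemidef (hS k)
  have hone (k : ℕ) : (Λ k - 1).PosSemidef := by
    rw [hΛ, add_sub_right_comm]
    exact hmin.add (hS k)
  clear ht
  induction t with
  | zero => simp [hΛ, div_self hΛ₀pd.det_pos.ne']
  | succ k ih =>
    rw [Finset.sum_Icc_succ_top (Nat.le_add_left 1 k), Nat.add_sub_cancel]
    set x := φ (k + 1) ⬝ᵥ ((Λ k)⁻¹ *ᵥ φ (k + 1)) with hx
    have hx₀ : 0 ≤ x := by
      simpa using (hpd k).inv.posSemidef.dotProduct_mulVec_nonneg (φ (k + 1))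
    have hx₁ : x ≤ 1 := by
      refine ((hpd k).dotProduct_inv_mulVec_le (hone k) _).trans ?_
      have hnorm : φ (k + 1) ⬝ᵥ φ (k + 1) = ‖φ (k + 1)‖ ^ 2 := by
        simp only [EuclideanSpace.real_norm_sq_eq, dotProduct, ← sq]
      rw [hnorm]
      exact pow_le_one₀ (norm_nonneg _) (hφ _ (Nat.le_add_left 1 k))
    have hlog : Real.log ((Λ (k + 1)).det / Λ₀.det)
        = Real.log ((Λ k).det / Λ₀.det) + Real.log (1 + x) := by
      rw [hsucc, det_add_vecMulVec (hpd k).det_pos.ne'.isUnit, ← hx, mul_div_right_comm,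
        Real.log_mul (div_pos (hpd k).det_pos hΛ₀pd.det_pos).ne' (by positivity)]
    have hle := Real.log_le_sub_one_of_pos (show 0 < 1 + x by positivity)
    have hge := Real.le_two_mul_log_one_add hx₀ (hx₁.trans one_le_two)
    rw [hlog]
    constructor <;> linarith [ih.1, ih.2]
end

section
/- Let λ ≥ 1, let φ_1, …, φ_T ∈ ℝ^d with ‖φ_t‖ ≤ 1 for all t, and set Λ_t = λ·I_d + ∑_{s=1}^t φ_s φ_sᵀ (so Λ_0 = λ·I_d). Then ∑_{t=1}^T φ_tᵀ Λ_{t−1}^{−1} φ_t ≤ 2 d log(1 + T/(λ d)). -/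
open Matrix

/-- Matrix determinant lemma for a rank-one update. -/
theorem det_add_vecMulVec_self {n : Type*} [Fintype n] [DecidableEq n] {A : Matrix n n ℝ}
    (hA : IsUnit A.det) (v : n → ℝ) :
    (A + vecMulVec v v).det = A.det * (1 + v ⬝ᵥ (A⁻¹ *ᵥ v)) := by
  rw [vecMulVec_eq Unit, det_add_replicateCol_mul_replicateRow hA]
  congr 1
  rw [det_unique]
  simp only [Matrix.add_apply, one_apply_eq, Matrix.mul_assoc]
  rfl

/-- The tangent-line bound on `log` summed over the eigenvalues. -/
theorem Matrix.PosDef.log_det_le {n : Type*} [Fintype n] [DecidableEq n] {A : Matrix n n ℝ}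
    (hA : A.PosDef) {c : ℝ} (hc : 0 < c) :
    Real.log A.det ≤ A.trace / c - Fintype.card n + Fintype.card n * Real.log c := by
  have hpos := hA.eigenvalues_pos
  have hdet : A.det = ∏ i, hA.isHermitian.eigenvalues i := by
    simpa using hA.isHermitian.det_eq_prod_eigenvalues
  have htr : A.trace = ∑ i, hA.isHermitian.eigenvalues i := by
    simpa using hA.isHermitian.trace_eq_sum_eigenvalues
  rw [hdet, htr, Real.log_prod fun i _ => (hpos i).ne']
  calc ∑ i, Real.log (hA.isHermitian.eigenvalues i)
      ≤ ∑ i, (hA.isHermitian.eigenvalues i / c - 1 + Real.log c) := by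
        refine Finset.sum_le_sum fun i _ => ?_
        have h := Real.log_le_sub_one_of_pos (div_pos (hpos i) hc)
        rw [Real.log_div (hpos i).ne' hc.ne'] at h
        linarith
    _ = _ := by
        simp [Finset.sum_add_distrib, Finset.sum_div]

theorem Matrix.PosDef.inv_quadForm_le_one {n : Type*} [Fintype n] [DecidableEq n]
    {A : Matrix n n ℝ} (hA : A.PosDef) (hA' : ∀ x : n → ℝ, x ⬝ᵥ x ≤ x ⬝ᵥ (A *ᵥ x))
    {v : n → ℝ} (hv : v ⬝ᵥ v ≤ 1) : v ⬝ᵥ (A⁻¹ *ᵥ v) ≤ 1 := by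
  set x := A⁻¹ *ᵥ v with hx
  have hAx : A *ᵥ x = v := by
    rw [hx, mulVec_mulVec, mul_nonsing_inv _ hA.det_pos.ne'.isUnit, one_mulVec]
  have h1 := hA' x
  rw [hAx, dotProduct_comm x v] at h1
  have h2 : 0 ≤ (v - x) ⬝ᵥ (v - x) := Finset.sum_nonneg fun i _ => mul_self_nonneg _
  simp only [sub_dotProduct, dotProduct_sub, dotProduct_comm x v] at h2
  linarith

theorem Real.le_two_mul_log_one_add_s2 {u : ℝ} (h0 : 0 ≤ u) (h1 : u ≤ 1) :
    u ≤ 2 * Real.log (1 + u) := by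
  have h := Real.le_log_one_add_of_nonneg h0
  have h' : u / 2 ≤ 2 * u / (u + 2) := by
    rw [div_le_div_iff₀ (by norm_num) (by linarith)]
    nlinarith
  linarith

theorem Matrix.posSemidef_sum_vecMulVec_self {n ι : Type*} [Fintype n] (s : Finset ι)
    (v : ι → n → ℝ) : (∑ i ∈ s, vecMulVec (v i) (v i)).PosSemidef :=
  posSemidef_sum s fun i _ => by simpa using posSemidef_vecMulVec_self_star (v i)

theorem stmt_2 (d T : ℕ) (lam : ℝ) (hlam : 1 ≤ lam)
    (φ : ℕ → EuclideanSpace ℝ (Fin d)) (hφ : ∀ t ∈ Finset.Icc 1 T, ‖φ t‖ ≤ 1)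
    (Λ : ℕ → Matrix (Fin d) (Fin d) ℝ)
    (hΛ : ∀ t, Λ t = lam • (1 : Matrix (Fin d) (Fin d) ℝ)
        + ∑ s ∈ Finset.Icc 1 t, Matrix.vecMulVec (φ s) (φ s)) :
    ∑ t ∈ Finset.Icc 1 T, (φ t) ⬝ᵥ ((Λ (t - 1))⁻¹ *ᵥ (φ t))
      ≤ 2 * d * Real.log (1 + T / (lam * d)) := by
  have hlam0 : 0 < lam := by linarith
  have hsum t := posSemidef_sum_vecMulVec_self (Finset.Icc 1 t) fun s => (φ s).ofLp
  have hpd t : (Λ t).PosDef := by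
    rw [hΛ]
    exact (PosDef.one.smul hlam0).add_posSemidef (hsum t)
  have hge t (x : Fin d → ℝ) : x ⬝ᵥ x ≤ x ⬝ᵥ (Λ t *ᵥ x) := by
    have h1 : 0 ≤ x ⬝ᵥ x := Finset.sum_nonneg fun i _ => mul_self_nonneg _
    have h2 := (hsum t).dotProduct_mulVec_nonneg x
    rw [star_trivial] at h2
    rw [hΛ, add_mulVec, smul_mulVec, one_mulVec, dotProduct_add, dotProduct_smul, smul_eq_mul]
    nlinarith
  have hnorm t (ht : t ∈ Finset.Icc 1 T) : (φ t).ofLp ⬝ᵥ (φ t).ofLp ≤ 1 := by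
    have h := EuclideanSpace.real_norm_sq_eq (φ t)
    have : (φ t).ofLp ⬝ᵥ (φ t).ofLp = ‖φ t‖ ^ 2 := by
      simp only [h, dotProduct, sq]
    rw [this]
    exact pow_le_one₀ (norm_nonneg _) (hφ t ht)
  have hpot : ∀ k ≤ T, ∑ t ∈ Finset.Icc 1 k, (φ t) ⬝ᵥ ((Λ (t - 1))⁻¹ *ᵥ (φ t))
      ≤ 2 * (Real.log (Λ k).det - d * Real.log lam) := by
    intro k
    induction k with
    | zero => intro _; simp [hΛ, Real.log_pow]
    | succ k ih =>
      intro hk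
      have hk' : k + 1 ∈ Finset.Icc 1 T := Finset.mem_Icc.2 ⟨by omega, hk⟩
      have hstep : Λ (k + 1) = Λ k + vecMulVec (φ (k + 1)).ofLp (φ (k + 1)).ofLp := by
        rw [hΛ, hΛ, Finset.sum_Icc_succ_top (by omega), add_assoc]
      have hu0 : 0 ≤ (φ (k + 1)).ofLp ⬝ᵥ ((Λ k)⁻¹ *ᵥ (φ (k + 1)).ofLp) := by
        simpa using (hpd k).inv.posSemidef.dotProduct_mulVec_nonneg (φ (k + 1)).ofLp
      have hu1 := (hpd k).inv_quadForm_le_one (hge k) (hnorm _ hk')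
      have hlog := Real.le_two_mul_log_one_add_s2 hu0 hu1
      rw [Finset.sum_Icc_succ_top (by omega), Nat.add_sub_cancel, hstep,
        det_add_vecMulVec_self (hpd k).det_pos.ne'.isUnit,
        Real.log_mul (hpd k).det_pos.ne' (by positivity)]
      linarith [ih (by omega)]
  have htrace : (Λ T).trace ≤ d * lam + T := by
    have h : ∑ t ∈ Finset.Icc 1 T, (φ t).ofLp ⬝ᵥ (φ t).ofLp ≤ T := by
      simpa using Finset.sum_le_sum hnorm
    rw [hΛ, trace_add, trace_sum]
    simp only [trace_smul, trace_one, Fintype.card_fin, trace_vecMulVec, smul_eq_mul]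
    linarith
  refine (hpot T le_rfl).trans ?_
  rcases Nat.eq_zero_or_pos d with rfl | hd
  · simp
  have hd' : (0 : ℝ) < d := by exact_mod_cast hd
  have hc : 0 < lam + T / d := by positivity
  have hdet := (hpd T).log_det_le hc
  have hdiv : (Λ T).trace / (lam + T / d) ≤ d := by
    rw [div_le_iff₀ hc]
    calc (Λ T).trace ≤ d * lam + T := htrace
      _ = d * (lam + T / d) := by field_simp
  have hlog : Real.log (1 + T / (lam * d)) = Real.log (lam + T / d) - Real.log lam := by
    rw [← Real.log_div hc.ne' hlam0.ne']
    congr 1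
    field_simp
  rw [Fintype.card_fin] at hdet
  rw [hlog]
  linarith
end

section
/- Let d, T ≥ 1, let λ ≥ 1, μ > 0, B ≥ 0, let φ_1, …, φ_T ∈ ℝ^d satisfy ‖φ_t‖ ≤ 1 for all t, and let w_1, …, w_T ∈ ℝ^d satisfy ‖w_t‖ ≤ B for all t. Then ∑_{t=1}^T [ w_tᵀ φ_t − μ ∑_{s=1}^{t−1} (w_tᵀ φ_s)² ] ≤ μ λ B² T + (d/(2μ)) · log(1 + T/(λ d)). -/
open Matrix

namespace Matrix

variable {n : Type*}

/-- The regularized Gram matrix `c I + ∑_{s=1}^k x_s x_sᵀ`. -/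
def regularizedGram [DecidableEq n] (c : ℝ) (x : ℕ → n → ℝ) (k : ℕ) : Matrix n n ℝ :=
  c • 1 + ∑ s ∈ Finset.Icc 1 k, vecMulVec (x s) (x s)

lemma regularizedGram_succ [DecidableEq n] (c : ℝ) (x : ℕ → n → ℝ) (k : ℕ) :
    regularizedGram c x (k + 1) = regularizedGram c x k + vecMulVec (x (k + 1)) (x (k + 1)) := by
  rw [regularizedGram, Finset.sum_Icc_succ_top (by omega), ← add_assoc, regularizedGram]

variable [Fintype n] [DecidableEq n]

lemma dotProduct_regularizedGram_mulVec (c : ℝ) (x : ℕ → n → ℝ) (k : ℕ) (y : n → ℝ) :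
    y ⬝ᵥ (regularizedGram c x k *ᵥ y) = c * (y ⬝ᵥ y) + ∑ s ∈ Finset.Icc 1 k, (y ⬝ᵥ x s) ^ 2 := by
  simp only [regularizedGram, add_mulVec, smul_mulVec, one_mulVec, sum_mulVec, dotProduct_add,
    dotProduct_smul, dotProduct_sum, vecMulVec_mulVec, smul_eq_mul,
    op_smul_eq_smul]
  congr 1
  refine Finset.sum_congr rfl fun s _ => ?_
  rw [dotProduct_comm (x s) y, sq]

lemma posDef_regularizedGram {c : ℝ} (hc : 0 < c) (x : ℕ → n → ℝ) (k : ℕ) :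
    (regularizedGram c x k).PosDef := by
  refine (PosDef.one.smul hc).add_posSemidef (posSemidef_sum _ fun s _ => ?_)
  simpa using posSemidef_vecMulVec_self_star (x s)

lemma trace_regularizedGram (c : ℝ) (x : ℕ → n → ℝ) (k : ℕ) :
    (regularizedGram c x k).trace
      = c * Fintype.card n + ∑ s ∈ Finset.Icc 1 k, x s ⬝ᵥ x s := by
  simp [regularizedGram, trace_sum, trace_vecMulVec]

/-- The matrix determinant lemma for a symmetric rank-one update. -/
lemma det_add_vecMulVec_self {A : Matrix n n ℝ} (hA : IsUnit A.det) (v : n → ℝ) :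
    (A + vecMulVec v v).det = A.det * (1 + v ⬝ᵥ (A⁻¹ *ᵥ v)) := by
  rw [vecMulVec_eq Unit, det_add_replicateCol_mul_replicateRow hA, Matrix.mul_assoc,
    ← replicateCol_mulVec, det_unique (n := Unit), add_apply, one_apply_eq,
    replicateRow_mul_replicateCol_apply]

lemma PosDef.mulVec_inv_mulVec {A : Matrix n n ℝ} (hA : A.PosDef) (v : n → ℝ) :
    A *ᵥ (A⁻¹ *ᵥ v) = v := by
  rw [mulVec_mulVec, mul_nonsing_inv _ ((isUnit_iff_isUnit_det A).mp hA.isUnit), one_mulVec]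

/-- Young's inequality for the dual pair of norms induced by `A` and `A⁻¹`. -/
lemma PosDef.dotProduct_le_young {A : Matrix n n ℝ} (hA : A.PosDef) {μ : ℝ} (hμ : 0 < μ)
    (w v : n → ℝ) :
    w ⬝ᵥ v ≤ μ * (w ⬝ᵥ (A *ᵥ w)) + (1 / (4 * μ)) * (v ⬝ᵥ (A⁻¹ *ᵥ v)) := by
  have h := hA.posSemidef.dotProduct_mulVec_nonneg (w - (1 / (2 * μ)) • (A⁻¹ *ᵥ v))
  have hsymm : (A⁻¹ *ᵥ v) ⬝ᵥ (A *ᵥ w) = w ⬝ᵥ v := by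
    have hT : Aᵀ = A := by simpa using hA.isHermitian.eq
    rw [dotProduct_mulVec, ← mulVec_transpose, hT, hA.mulVec_inv_mulVec, dotProduct_comm]
  simp only [star_trivial, mulVec_sub, mulVec_smul, hA.mulVec_inv_mulVec, dotProduct_sub,
    sub_dotProduct, smul_dotProduct, dotProduct_smul, smul_eq_mul, hsymm,
    dotProduct_comm (A⁻¹ *ᵥ v) v] at h
  have h' := mul_nonneg hμ.le h
  have key : μ * (w ⬝ᵥ (A *ᵥ w) - 1 / (2 * μ) * (w ⬝ᵥ v)
      - 1 / (2 * μ) * (w ⬝ᵥ v - 1 / (2 * μ) * (v ⬝ᵥ (A⁻¹ *ᵥ v))))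
      = μ * (w ⬝ᵥ (A *ᵥ w)) - w ⬝ᵥ v + (1 / (4 * μ)) * (v ⬝ᵥ (A⁻¹ *ᵥ v)) := by
    field_simp
    ring
  linarith

/-- AM-GM for the eigenvalues, in logarithmic form. -/
lemma PosDef.log_det_le_s5 {A : Matrix n n ℝ} (hA : A.PosDef) {m : ℝ} (hm : 0 < m)
    (htr : A.trace ≤ Fintype.card n * m) :
    Real.log A.det ≤ Fintype.card n * Real.log m := by
  have hdet : A.det = ∏ i, hA.isHermitian.eigenvalues i := by
    simpa using hA.isHermitian.det_eq_prod_eigenvalues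
  have htrace : A.trace = ∑ i, hA.isHermitian.eigenvalues i := by
    simpa using hA.isHermitian.trace_eq_sum_eigenvalues
  rw [hdet, Real.log_prod fun i _ => (hA.eigenvalues_pos i).ne']
  have hle : ∀ i, Real.log (hA.isHermitian.eigenvalues i)
      ≤ Real.log m + (hA.isHermitian.eigenvalues i / m - 1) := fun i => by
    have hi := hA.eigenvalues_pos i
    have := Real.log_le_sub_one_of_pos (div_pos hi hm)
    rw [Real.log_div hi.ne' hm.ne'] at this
    linarith
  refine (Finset.sum_le_sum fun i _ => hle i).trans ?_
  have : (∑ i, hA.isHermitian.eigenvalues i) / m ≤ Fintype.card n := by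
    rw [← htrace, div_le_iff₀ hm]
    exact htr
  simp only [Finset.sum_add_distrib, Finset.sum_sub_distrib, ← Finset.sum_div,
    Finset.sum_const, Finset.card_univ, nsmul_eq_mul, mul_one]
  linarith

lemma dotProduct_inv_regularizedGram_mulVec_le_one {c : ℝ} (hc : 1 ≤ c) (x : ℕ → n → ℝ) (k : ℕ)
    {v : n → ℝ} (hv : v ⬝ᵥ v ≤ 1) :
    v ⬝ᵥ ((regularizedGram c x k)⁻¹ *ᵥ v) ≤ 1 := by
  have hA := posDef_regularizedGram (zero_lt_one.trans_le hc) x k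
  set y := (regularizedGram c x k)⁻¹ *ᵥ v
  have h := dotProduct_regularizedGram_mulVec c x k y
  rw [hA.mulVec_inv_mulVec, dotProduct_comm] at h
  have hsum : 0 ≤ ∑ s ∈ Finset.Icc 1 k, (y ⬝ᵥ x s) ^ 2 := Finset.sum_nonneg fun _ _ => sq_nonneg _
  have hy : 0 ≤ y ⬝ᵥ y := by simpa using dotProduct_star_self_nonneg y
  have hvy : 0 ≤ (v - y) ⬝ᵥ (v - y) := by simpa using dotProduct_star_self_nonneg (v - y)
  simp only [dotProduct_sub, sub_dotProduct, dotProduct_comm y v] at hvy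
  nlinarith

/-- The elliptical potential lemma. -/
lemma sum_dotProduct_inv_regularizedGram_le {c : ℝ} (hc : 1 ≤ c) (x : ℕ → n → ℝ) (k : ℕ)
    (hx : ∀ t ∈ Finset.Icc 1 k, x t ⬝ᵥ x t ≤ 1) :
    ∑ t ∈ Finset.Icc 1 k, x t ⬝ᵥ ((regularizedGram c x (t - 1))⁻¹ *ᵥ x t)
      ≤ 2 * (Real.log (regularizedGram c x k).det - Fintype.card n * Real.log c) := by
  have hc0 : 0 < c := zero_lt_one.trans_le hc
  induction k with
  | zero => simp [regularizedGram]
  | succ k ih =>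
    have hA := posDef_regularizedGram hc0 x k
    have hv : x (k + 1) ⬝ᵥ x (k + 1) ≤ 1 := hx _ (by simp)
    have hu := dotProduct_inv_regularizedGram_mulVec_le_one hc x k hv
    have hu0 : 0 ≤ x (k + 1) ⬝ᵥ ((regularizedGram c x k)⁻¹ *ᵥ x (k + 1)) := by
      simpa using hA.inv.posSemidef.dotProduct_mulVec_nonneg (x (k + 1))
    specialize ih fun t ht => hx t (by simp only [Finset.mem_Icc] at ht ⊢; omega)
    rw [Finset.sum_Icc_succ_top (by omega), regularizedGram_succ,
      det_add_vecMulVec_self hA.det_pos.ne'.isUnit, Real.log_mul hA.det_pos.ne' (by linarith),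
      Nat.add_sub_cancel]
    set u := x (k + 1) ⬝ᵥ ((regularizedGram c x k)⁻¹ *ᵥ x (k + 1))
    have hlog : u / 2 ≤ Real.log (1 + u) := by
      have h1 := Real.one_sub_inv_le_log_of_pos (show 0 < 1 + u by linarith)
      have h2 : u / 2 ≤ 1 - (1 + u)⁻¹ := by
        rw [show 1 - (1 + u)⁻¹ = u / (1 + u) by field_simp; ring]
        exact div_le_div_of_nonneg_left hu0 (by linarith) (by linarith)
      exact h2.trans h1
    linarith

end Matrix

/-- Deterministic decoupling bound (core of Proposition 4.1): with `d, T ≥ 1`,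
`λ ≥ 1`, `μ > 0`, `B ≥ 0`, `‖φ_t‖ ≤ 1` and `‖w_t‖ ≤ B` (Euclidean norms),
`∑_{t=1}^T [ w_tᵀ φ_t − μ ∑_{s=1}^{t−1} (w_tᵀ φ_s)² ]
  ≤ μ λ B² T + (d/(2μ)) log (1 + T/(λ d))`. -/
theorem stmt_5 (d T : ℕ) (hd : 1 ≤ d) (hT : 1 ≤ T) (lam μ B : ℝ)
    (hlam : 1 ≤ lam) (hμ : 0 < μ) (hB : 0 ≤ B)
    (φ w : ℕ → EuclideanSpace ℝ (Fin d))
    (hφ : ∀ t ∈ Finset.Icc 1 T, ‖φ t‖ ≤ 1)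
    (hw : ∀ t ∈ Finset.Icc 1 T, ‖w t‖ ≤ B) :
    ∑ t ∈ Finset.Icc 1 T,
        ((w t) ⬝ᵥ (φ t) - μ * ∑ s ∈ Finset.Icc 1 (t - 1), ((w t) ⬝ᵥ (φ s)) ^ 2)
      ≤ μ * lam * B ^ 2 * T + ((d : ℝ) / (2 * μ)) * Real.log (1 + T / (lam * d)) := by
  have hlam0 : 0 < lam := zero_lt_one.trans_le hlam
  have hd0 : (0 : ℝ) < d := by exact_mod_cast hd
  have hnorm : ∀ v : EuclideanSpace ℝ (Fin d), v.ofLp ⬝ᵥ v.ofLp = ‖v‖ ^ 2 := fun v => by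
    rw [EuclideanSpace.real_norm_sq_eq]
    simp [dotProduct, sq]
  set x : ℕ → Fin d → ℝ := fun t => (φ t).ofLp with hx
  have hx1 : ∀ t ∈ Finset.Icc 1 T, x t ⬝ᵥ x t ≤ 1 := fun t ht => by
    rw [hx, hnorm]
    exact pow_le_one₀ (norm_nonneg _) (hφ t ht)
  have hstep : ∀ t ∈ Finset.Icc 1 T,
      (w t) ⬝ᵥ (φ t) - μ * ∑ s ∈ Finset.Icc 1 (t - 1), ((w t) ⬝ᵥ (φ s)) ^ 2
        ≤ μ * lam * B ^ 2
          + (1 / (4 * μ)) * (x t ⬝ᵥ ((regularizedGram lam x (t - 1))⁻¹ *ᵥ x t)) := by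
    intro t ht
    have hy := (posDef_regularizedGram hlam0 x (t - 1)).dotProduct_le_young hμ (w t).ofLp (x t)
    rw [dotProduct_regularizedGram_mulVec, hnorm, mul_add, ← mul_assoc] at hy
    have hwB : μ * lam * ‖w t‖ ^ 2 ≤ μ * lam * B ^ 2 := by
      have := hw t ht
      gcongr
    linarith
  have hpot := sum_dotProduct_inv_regularizedGram_le hlam x T hx1
  have hm : 0 < lam + T / d := by positivity
  have hdet := (posDef_regularizedGram hlam0 x T).log_det_le_s5 hm (by
    have hs := Finset.sum_le_sum hx1
    rw [trace_regularizedGram, Fintype.card_fin, mul_add, mul_div_cancel₀ _ hd0.ne']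
    simp only [Finset.sum_const, Nat.card_Icc, Nat.add_sub_cancel, nsmul_eq_mul, mul_one] at hs
    linarith)
  rw [Fintype.card_fin] at hpot hdet
  have hlog : Real.log (1 + T / (lam * d)) = Real.log (lam + T / d) - Real.log lam := by
    rw [← Real.log_div hm.ne' hlam0.ne']
    congr 1
    field_simp
  refine (Finset.sum_le_sum hstep).trans ?_
  rw [Finset.sum_add_distrib, hlog]
  simp only [Finset.sum_const, Nat.card_Icc, Nat.add_sub_cancel, nsmul_eq_mul]
  have hfin : 1 / (4 * μ) * ∑ t ∈ Finset.Icc 1 T,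
        x t ⬝ᵥ ((regularizedGram lam x (t - 1))⁻¹ *ᵥ x t)
      ≤ 1 / (4 * μ) * (2 * (d * Real.log (lam + T / d) - d * Real.log lam)) := by
    gcongr
    linarith
  rw [Finset.mul_sum] at hfin
  have heq : 1 / (4 * μ) * (2 * (d * Real.log (lam + T / d) - d * Real.log lam))
      = d / (2 * μ) * (Real.log (lam + T / d) - Real.log lam) := by
    field_simp
    ring
  linarith
end

section
/- Let β ≥ 1 and let Z be a bounded real random variable on a probability space such that −β ≤ Z ≤ β − 1 almost surely and ess sup Z − ess inf Z ≤ β. Then E[ Z² − (Z − E Z)² ] = (E Z)² and E[ ( Z² − (Z − E Z)² )² ] ≤ (4/3) β² (E Z)². -/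
open MeasureTheory

/-- A second-moment bound for a random variable with values in `[a, b]`. -/
theorem integral_sq_le_of_mem_Icc {Ω : Type*} [MeasurableSpace Ω] (μ : Measure Ω)
    [IsProbabilityMeasure μ] {Z : Ω → ℝ} {a b : ℝ} (hZ : Integrable Z μ)
    (hZ2 : Integrable (fun ω => Z ω ^ 2) μ) (h : ∀ᵐ ω ∂μ, a ≤ Z ω ∧ Z ω ≤ b) :
    ∫ ω, Z ω ^ 2 ∂μ ≤ (a + b) * ∫ ω, Z ω ∂μ - a * b := by
  have key : ∫ ω, Z ω ^ 2 ∂μ ≤ ∫ ω, ((a + b) * Z ω - a * b) ∂μ := by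
    refine integral_mono_ae hZ2 ((hZ.const_mul _).sub (integrable_const _)) ?_
    filter_upwards [h] with ω hω
    nlinarith [mul_nonneg (sub_nonneg.2 hω.1) (sub_nonneg.2 hω.2)]
  rwa [integral_sub (hZ.const_mul _) (integrable_const _), integral_const_mul, integral_const,
    probReal_univ, one_smul] at key

theorem sq_sub_mul_add_sq_le {a b β : ℝ} (hab : a ≤ b) (ha : -β ≤ a) (hb : b ≤ β)
    (h : b - a ≤ β) : a ^ 2 - a * b + b ^ 2 ≤ β ^ 2 := by
  rcases le_total 0 a with h0 | h0
  · nlinarith [mul_nonneg h0 (sub_nonneg.2 hab)]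
  · rcases le_total b 0 with h1 | h1
    · nlinarith [mul_nonneg (neg_nonneg.2 h1) (sub_nonneg.2 hab)]
    · nlinarith [mul_nonneg (neg_nonneg.2 h0) h1]

/-- Probabilistic core of Lemma B.1: if `β ≥ 1` and `Z` is a bounded random variable
with `−β ≤ Z ≤ β − 1` a.s. and `ess sup Z − ess inf Z ≤ β`, then
`E[Z² − (Z − EZ)²] = (EZ)²` and `E[(Z² − (Z − EZ)²)²] ≤ (4/3) β² (EZ)²`. -/
theorem stmt_11 {Ω : Type*} [MeasurableSpace Ω] (μ : Measure Ω) [IsProbabilityMeasure μ]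
    (β : ℝ) (hβ : 1 ≤ β) (Z : Ω → ℝ) (hZmeas : Measurable Z)
    (hZbd : ∀ᵐ ω ∂μ, -β ≤ Z ω ∧ Z ω ≤ β - 1)
    (hrange : essSup Z μ - essInf Z μ ≤ β) :
    (∫ ω, (Z ω ^ 2 - (Z ω - ∫ ω', Z ω' ∂μ) ^ 2) ∂μ = (∫ ω, Z ω ∂μ) ^ 2) ∧
    (∫ ω, (Z ω ^ 2 - (Z ω - ∫ ω', Z ω' ∂μ) ^ 2) ^ 2 ∂μ
      ≤ (4 / 3) * β ^ 2 * (∫ ω, Z ω ∂μ) ^ 2) := by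
  have hL : ∀ᵐ ω ∂μ, -β ≤ Z ω := hZbd.mono fun _ h => h.1
  have hU : ∀ᵐ ω ∂μ, Z ω ≤ β - 1 := hZbd.mono fun _ h => h.2
  have hba : Filter.IsBoundedUnder (· ≤ ·) (ae μ) Z := Filter.isBoundedUnder_of_eventually_le hU
  have hbb : Filter.IsBoundedUnder (· ≥ ·) (ae μ) Z := Filter.isBoundedUnder_of_eventually_ge hL
  have hZ : Integrable Z μ := .of_mem_Icc (-β) (β - 1) hZmeas.aemeasurable hZbd
  have hZ2 : Integrable (fun ω => Z ω ^ 2) μ := by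
    refine .of_mem_Icc 0 (β ^ 2) (hZmeas.pow_const 2).aemeasurable ?_
    filter_upwards [hZbd] with ω hω
    exact ⟨sq_nonneg _, by nlinarith⟩
  have hsup : ∀ᵐ ω ∂μ, Z ω ≤ essSup Z μ := ae_le_essSup hba
  have hinf : ∀ᵐ ω ∂μ, essInf Z μ ≤ Z ω := ae_essInf_le hbb
  have hsupU : essSup Z μ ≤ β - 1 :=
    Filter.limsup_le_of_le hbb.isCoboundedUnder_le hU
  have hinfL : -β ≤ essInf Z μ :=
    Filter.le_liminf_of_le hba.isCoboundedUnder_ge hL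
  obtain ⟨ω₀, hω₀, hω₁⟩ := (hinf.and hsup).exists
  have hmom := integral_sq_le_of_mem_Icc μ hZ hZ2 (hinf.and hsup)
  have hquad := sq_sub_mul_add_sq_le (hω₀.trans hω₁) hinfL (by linarith) hrange
  set e := ∫ ω, Z ω ∂μ with he
  set a := essInf Z μ
  set b := essSup Z μ
  constructor
  · have : ∀ ω, Z ω ^ 2 - (Z ω - e) ^ 2 = 2 * e * Z ω - e ^ 2 := fun ω => by ring
    simp_rw [this]
    rw [integral_sub (hZ.const_mul _) (integrable_const _), integral_const_mul, integral_const,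
      probReal_univ, one_smul, ← he]
    ring
  · have : ∀ ω, (Z ω ^ 2 - (Z ω - e) ^ 2) ^ 2
        = 4 * e ^ 2 * Z ω ^ 2 - 4 * e ^ 3 * Z ω + e ^ 4 := fun ω => by ring
    simp_rw [this]
    have hint : Integrable (fun ω => 4 * e ^ 2 * Z ω ^ 2 - 4 * e ^ 3 * Z ω) μ :=
      (hZ2.const_mul _).sub (hZ.const_mul _)
    rw [integral_add hint (integrable_const _),
      integral_sub (hZ2.const_mul _) (hZ.const_mul _), integral_const_mul, integral_const_mul,
      integral_const, probReal_univ, one_smul, ← he]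
    have hfac : 4 * (∫ ω, Z ω ^ 2 ∂μ) - 3 * e ^ 2 ≤ 4 / 3 * β ^ 2 := by
      nlinarith [sq_nonneg (3 * e - 2 * (a + b))]
    nlinarith [mul_le_mul_of_nonneg_left hfac (sq_nonneg e)]
end

section
/- The function ψ : ℝ → ℝ defined by ψ(z) = (exp(z) − 1 − z)/z² for z ≠ 0 and ψ(0) = 1/2 is monotone increasing on ℝ. -/
/-- The second-order Taylor remainder quotient of `exp` at `0`, in integral form. -/
theorem integral_one_sub_mul_exp_mul (z : ℝ) :
    ∫ s in (0 : ℝ)..1, (1 - s) * Real.exp (s * z) =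
      if z = 0 then 1 / 2 else (Real.exp z - 1 - z) / z ^ 2 := by
  split_ifs with hz
  · subst hz
    simp only [mul_zero, Real.exp_zero, mul_one]
    rw [intervalIntegral.integral_sub (by simp) (by simp)]
    norm_num
  · have hderiv : ∀ s ∈ Set.uIcc (0 : ℝ) 1,
        HasDerivAt (fun s => (1 - s) * Real.exp (s * z) / z + Real.exp (s * z) / z ^ 2)
          ((1 - s) * Real.exp (s * z)) s := by
      intro s _
      have hexp : HasDerivAt (fun s => Real.exp (s * z)) (Real.exp (s * z) * (1 * z)) s :=
        ((hasDerivAt_id s).mul_const z).exp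
      refine (((((hasDerivAt_id s).const_sub 1).mul hexp).div_const z).add
        (hexp.div_const (z ^ 2))).congr_deriv ?_
      simp only [id]
      field_simp
      ring
    rw [intervalIntegral.integral_eq_sub_of_hasDerivAt hderiv
      (Continuous.intervalIntegrable (by fun_prop) _ _)]
    simp only [sub_self, zero_mul, one_mul, zero_div, sub_zero, Real.exp_zero, zero_add]
    field_simp
    ring

/-- The function `ψ(z) = (exp z − 1 − z)/z²` (extended by `ψ(0) = 1/2`) is monotone
increasing on `ℝ`. -/
theorem stmt_13 :
    Monotone (fun z : ℝ =>
      if z = 0 then 1 / 2 else (Real.exp z - 1 - z) / z ^ 2) := by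
  intro x y hxy
  simp only [← integral_one_sub_mul_exp_mul]
  refine intervalIntegral.integral_mono_on zero_le_one
    (Continuous.intervalIntegrable (by fun_prop) _ _)
    (Continuous.intervalIntegrable (by fun_prop) _ _) fun s hs => ?_
  exact mul_le_mul_of_nonneg_left
    (Real.exp_le_exp.2 (mul_le_mul_of_nonneg_left hxy hs.1)) (sub_nonneg.2 hs.2)
end

section
/- Let β ≥ 1, let η > 0 satisfy η β² ≤ 0.8, and let Z be a bounded real random variable such that −β ≤ Z ≤ β − 1 almost surely and ess sup Z − ess inf Z ≤ β. Set W = Z² − (Z − E Z)². Then log E[exp(−η W)] ≤ E[exp(−η W)] − 1 ≤ −0.25 · η · (E Z)². -/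
open MeasureTheory

/-- Probabilistic core of Lemma B.2: with `β ≥ 1`, `η β² ≤ 0.8`, `Z` bounded with
`−β ≤ Z ≤ β − 1` a.s., `ess sup Z − ess inf Z ≤ β`, and
`W = Z² − (Z − EZ)²`, one has
`log E[exp(−η W)] ≤ E[exp(−η W)] − 1 ≤ −0.25 η (EZ)²`. -/
theorem stmt_14 {Ω : Type*} [MeasurableSpace Ω] (μ : Measure Ω) [IsProbabilityMeasure μ]
    (β η : ℝ) (hβ : 1 ≤ β) (hη : 0 < η) (hηβ : η * β ^ 2 ≤ 0.8)
    (Z : Ω → ℝ) (hZmeas : Measurable Z)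
    (hZbd : ∀ᵐ ω ∂μ, -β ≤ Z ω ∧ Z ω ≤ β - 1)
    (hrange : essSup Z μ - essInf Z μ ≤ β)
    (W : Ω → ℝ) (hW : ∀ ω, W ω = Z ω ^ 2 - (Z ω - ∫ ω', Z ω' ∂μ) ^ 2) :
    Real.log (∫ ω, Real.exp (-η * W ω) ∂μ) ≤ (∫ ω, Real.exp (-η * W ω) ∂μ) - 1 ∧
    (∫ ω, Real.exp (-η * W ω) ∂μ) - 1 ≤ -0.25 * η * (∫ ω, Z ω ∂μ) ^ 2 := by
  set m := ∫ ω, Z ω ∂μ with hm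
  have h_inf : ∀ᵐ ω ∂μ, essInf Z μ ≤ Z ω :=
    ae_essInf_le ⟨-β, by simpa using hZbd.mono fun _ h => h.1⟩
  have h_sup : ∀ᵐ ω ∂μ, Z ω ≤ essSup Z μ :=
    ae_le_essSup ⟨β - 1, by simpa using hZbd.mono fun _ h => h.2⟩
  have h_sub := ProbabilityTheory.hasSubgaussianMGF_of_mem_Icc hZmeas.aemeasurable
    (h_inf.and h_sup)
  have h_range : 0 ≤ essSup Z μ - essInf Z μ := by
    obtain ⟨ω, h₁, h₂⟩ := (h_inf.and h_sup).exists
    linarith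
  have h_exp : (fun ω => Real.exp (-η * W ω)) =
      fun ω => Real.exp (-η * m ^ 2) * Real.exp (-2 * η * m * (Z ω - m)) := by
    funext ω
    rw [hW, ← Real.exp_add]
    ring_nf
  have h_int : Integrable (fun ω => Real.exp (-η * W ω)) μ := by
    rw [h_exp]
    exact (h_sub.integrable_exp_mul _).const_mul _
  have h_abs : |m| ≤ β := by
    have h := norm_integral_le_of_norm_le_const (μ := μ) (f := Z) (C := β)
      (hZbd.mono fun ω h => abs_le.2 ⟨h.1, by linarith [h.2]⟩)
    simpa using h
  have h_sq : η * m ^ 2 ≤ 0.8 :=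
    le_trans (mul_le_mul_of_nonneg_left (sq_le_sq' (abs_le.1 h_abs).1 (abs_le.1 h_abs).2) hη.le)
      hηβ
  have h_nonneg : 0 ≤ η * m ^ 2 := by positivity
  have h_mgf : ∫ ω, Real.exp (-η * W ω) ∂μ ≤ Real.exp (-(0.6 * (η * m ^ 2))) := by
    have h := h_sub.mgf_le (-2 * η * m)
    rw [h_exp, integral_const_mul]
    refine (mul_le_mul_of_nonneg_left h (Real.exp_nonneg _)).trans ?_
    rw [← Real.exp_add, Real.exp_le_exp]
    push_cast
    rw [Real.norm_eq_abs, div_pow, sq_abs]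
    have h₁ : η * (essSup Z μ - essInf Z μ) ^ 2 ≤ 0.8 :=
      (mul_le_mul_of_nonneg_left (pow_le_pow_left₀ h_range hrange 2) hη.le).trans hηβ
    linarith [mul_le_mul_of_nonneg_left h₁ h_nonneg]
  refine ⟨Real.log_le_sub_one_of_pos (integral_exp_pos h_int), ?_⟩
  have h_inv : Real.exp (-(0.6 * (η * m ^ 2))) ≤ 1 - 0.25 * (η * m ^ 2) := by
    rw [Real.exp_neg]
    refine inv_le_of_inv_le₀ (by linarith) (le_trans ?_ (Real.add_one_le_exp _))
    rw [inv_le_iff_one_le_mul₀ (by linarith)]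
    nlinarith
  linarith
end
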